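/- arXiv:2007.12376 — 3 statements merged into one kernel-verified Lean document; each statement's English description precedes it below -/
import Mathlib

section
/- Let K be a field extension of ℂ which is finitely generated of transcendence degree 1 over ℂ (the function field of a projective curve), and let 𝔤 be a finite-dimensional Lie subalgebra of the Lie algebra Derivation ℂ K K of ℂ-derivations of K (rational vector fields), with dim_ℂ 𝔤 ≥ 2. Then there exists an element φ ∈ K, transcendental over ℂ, such that for every v ∈ 𝔤 the element v(φ) lies in the ℂ-linear span of {1, φ, φ²}. (Equivalently, 𝔤 is contained in the pull-back under the map defined by φ of the Lie algebra 𝔰𝔩₂ of vector fields on ℙ¹.) -/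
/-- A derivation over a field of characteristic zero kills all algebraic elements. -/
theorem Derivation.apply_eq_zero_of_isAlgebraic {L K : Type*} [Field L] [CharZero L] [Field K]
    [Algebra L K] (D : Derivation L K K) {a : K} (ha : IsAlgebraic L a) : D a = 0 := by
  have hint : IsIntegral L a := ha.isIntegral
  have hsep := (minpoly.irreducible hint).separable.aeval_derivative_ne_zero (minpoly.aeval L a)
  have h := D.map_aeval (minpoly L a) a
  rw [minpoly.aeval, map_zero, smul_eq_mul, eq_comm, mul_eq_zero] at h
  exact h.resolve_left hsep

/-- A derivation that kills a generator of a subfield kills everything algebraic over it. -/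
theorem Derivation.apply_eq_zero_of_isAlgebraic_adjoin {k K : Type*} [Field k] [CharZero k]
    [Field K] [Algebra k K] (D : Derivation k K K) {x a : K} (hx : D x = 0)
    (ha : IsAlgebraic (IntermediateField.adjoin k {x}) a) : D a = 0 := by
  have hconst : ∀ c ∈ IntermediateField.adjoin k {x}, D c = 0 := fun c hc ↦ by
    induction hc using IntermediateField.adjoin_induction with
    | mem y hy => rwa [Set.mem_singleton_iff.mp hy]
    | algebraMap r => exact D.map_algebraMap r
    | add y z _ _ hy hz => rw [map_add, hy, hz, add_zero]
    | mul y z _ _ hy hz => rw [D.leibniz, hy, hz, smul_zero, smul_zero, add_zero]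
    | inv y _ hy => rw [D.leibniz_inv, hy, smul_zero]
  let D' : Derivation (IntermediateField.adjoin k {x}) K K :=
    { toFun := D
      map_add' := map_add D
      map_smul' := fun c y ↦ by
        rw [Algebra.smul_def, D.leibniz, IntermediateField.algebraMap_apply, hconst c c.2,
          smul_zero, add_zero]
        rfl
      map_one_eq_zero' := D.map_one_eq_zero
      leibniz' := D.leibniz }
  exact D'.apply_eq_zero_of_isAlgebraic ha

/-- In transcendence degree one, the constants of a nonzero derivation are algebraic. -/
theorem Derivation.isAlgebraic_of_apply_eq_zero {k K : Type*} [Field k] [CharZero k]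
    [Field K] [Algebra k K] {t : K} (ht : Transcendental k t)
    (halg : Algebra.IsAlgebraic (IntermediateField.adjoin k {t}) K)
    {D : Derivation k K K} (hD : D ≠ 0) {x : K} (hx : D x = 0) : IsAlgebraic k x := by
  by_contra htr
  refine hD (Derivation.ext fun a ↦ D.apply_eq_zero_of_isAlgebraic_adjoin (x := t) ?_
    (halg.isAlgebraic a))
  exact D.apply_eq_zero_of_isAlgebraic_adjoin hx <| IntermediateField.isAlgebraic_adjoin_iff.mpr <|
    .adjoin_singleton ht htr (IntermediateField.isAlgebraic_adjoin_iff.mp (halg.isAlgebraic x))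

/-- Elements algebraic over an algebraically closed field lie in it. -/
theorem IsAlgClosed.exists_algebraMap_eq {k K : Type*} [Field k] [IsAlgClosed k]
    [Field K] [Algebra k K] {x : K} (hx : IsAlgebraic k x) : ∃ c : k, algebraMap k K c = x :=
  minpoly.mem_range_of_degree_eq_one k x
    (IsAlgClosed.degree_eq_one_of_irreducible k (minpoly.irreducible hx.isIntegral))

/-- A finite-dimensional subspace cannot contain all `g * f ^ n` with `f` transcendental. -/
theorem Submodule.exists_mul_pow_notMem {k K : Type*} [Field k] [Field K] [Algebra k K]
    (F : Submodule k K) [FiniteDimensional k F] {f g : K} (hf : Transcendental k f) (hg : g ≠ 0) :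
    ∃ n : ℕ, g * f ^ n ∉ F := by
  by_contra! h
  have hpow : LinearIndependent k fun n : ℕ ↦ f ^ n := by
    simpa [Function.comp_def] using (Polynomial.basisMonomials k).linearIndependent.map'
      (Polynomial.aeval f).toLinearMap
      (LinearMap.ker_eq_bot.mpr (transcendental_iff_injective.mp hf))
  have hli : LinearIndependent k fun n : ℕ ↦ g * f ^ n :=
    hpow.map' (LinearMap.mulLeft k g) (LinearMap.ker_eq_bot.mpr (mul_right_injective₀ hg))
  have hF : LinearIndependent k fun n : ℕ ↦ (⟨g * f ^ n, h n⟩ : F) :=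
    LinearIndependent.of_comp F.subtype hli
  exact not_finite_iff_infinite.mpr inferInstance hF.finite

/-- If on an invariant finite-dimensional subspace `F` the kernels of the powers of `T - μ` are
stationary from the exponent `n μ` on, then `F` is spanned by these kernels. -/
theorem Submodule.le_of_stable_genEigenspaces {k V : Type*} [Field k] [IsAlgClosed k]
    [AddCommGroup V] [Module k V] (T : Module.End k V) (F P : Submodule k V)
    [FiniteDimensional k F] (hF : ∀ x ∈ F, T x ∈ F) (n : k → ℕ)
    (hstable : ∀ μ, ∀ x ∈ F, ((T - μ • 1) ^ (n μ + 1)) x = 0 → ((T - μ • 1) ^ n μ) x = 0)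
    (hP : ∀ μ, ∀ x ∈ F, ((T - μ • 1) ^ n μ) x = 0 → x ∈ P) : F ≤ P := by
  let S : Module.End k F := T.restrict hF
  have hcoe : ∀ (μ : k) (m : ℕ) (x : F),
      (((S - μ • 1) ^ m) x : V) = ((T - μ • 1) ^ m) (x : V) := by
    intro μ m
    induction m with
    | zero => simp
    | succ m ih =>
      intro x
      rw [pow_succ, pow_succ, Module.End.mul_apply, Module.End.mul_apply, ih]
      simp [S]
  have hle : ∀ μ, S.maxGenEigenspace μ ≤ P.comap F.subtype := by
    intro μ x hx
    obtain ⟨m, hm⟩ := (Module.End.mem_maxGenEigenspace S μ x).mp hx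
    have hker : LinearMap.ker ((S - μ • 1) ^ n μ) = LinearMap.ker ((S - μ • 1) ^ (n μ).succ) := by
      refine le_antisymm (fun y hy ↦ ?_) (fun y hy ↦ ?_)
      · rw [LinearMap.mem_ker] at hy ⊢
        rw [Nat.succ_eq_add_one, pow_succ', Module.End.mul_apply, hy, map_zero]
      · rw [LinearMap.mem_ker] at hy ⊢
        apply Subtype.ext
        rw [hcoe]
        exact hstable μ y y.2 (by rw [← hcoe]; exact congrArg Subtype.val hy)
    have hmem : x ∈ LinearMap.ker ((S - μ • 1) ^ (n μ + m)) := by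
      rw [LinearMap.mem_ker, pow_add, Module.End.mul_apply, hm, map_zero]
    rw [← Module.End.ker_pow_constant hker, LinearMap.mem_ker] at hmem
    exact hP μ x x.2 (by rw [← hcoe, hmem]; rfl)
  intro x hx
  have htop : (⟨x, hx⟩ : F) ∈ ⨆ μ, S.maxGenEigenspace μ := by
    rw [Module.End.iSup_maxGenEigenspace_eq_top]; trivial
  exact iSup_le hle htop

/-- If `F • D` is a finite-dimensional Lie algebra and `f, g ∈ F` are eigenvectors of `D`, the
eigenvalue of `g` is `1 - n` times that of `f` for some natural number `n`; otherwise bracketing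
with `f` repeatedly would put every `g * f ^ n` in `F`. -/
theorem exists_eigenvalue_eq_of_bracket_mem {k K : Type*} [Field k] [Field K] [Algebra k K]
    {D : Derivation k K K} {F : Submodule k K} [FiniteDimensional k F]
    (hF : ∀ f ∈ F, ∀ g ∈ F, f * D g - g * D f ∈ F) {f g : K} (hf : f ∈ F) (hg : g ∈ F)
    (hftr : Transcendental k f) (hg0 : g ≠ 0) {a b : k} (hDf : D f = a • f) (hDg : D g = b • g) :
    ∃ n : ℕ, b = (1 - n) * a := by
  by_contra! hne
  obtain ⟨n, hn⟩ := F.exists_mul_pow_notMem hftr hg0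
  have hD : ∀ n : ℕ, D (g * f ^ n) = (b + n * a) • (g * f ^ n) := by
    intro n
    induction n with
    | zero => simp [hDg]
    | succ n ih =>
      rw [pow_succ, ← mul_assoc, D.leibniz, ih, hDf]
      simp only [smul_eq_mul]
      simp only [Algebra.smul_def, map_add, map_mul, map_natCast, Nat.cast_add, Nat.cast_one,
        map_one]
      ring
  refine hn ?_
  clear hn
  induction n with
  | zero => simpa using hg
  | succ n ih =>
    have hbr := hF _ ih _ hf
    have hc : (1 - n) * a - b ≠ 0 := sub_ne_zero.mpr (hne n).symm
    have heq : g * f ^ n * D f - f * D (g * f ^ n) = ((1 - n) * a - b) • (g * f ^ (n + 1)) := by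
      rw [hD, hDf]
      simp only [Algebra.smul_def, map_sub, map_add, map_mul, map_one, map_natCast]
      ring
    rw [heq] at hbr
    exact (F.smul_mem_iff hc).mp hbr

/-- If `F • D` is a finite-dimensional Lie algebra containing `D` and `f ∈ F` is an eigenvector of
`D` with nonzero eigenvalue, then `F` is contained in the span of `1`, `f` and `f⁻¹`. -/
theorem le_span_of_eigenvector {k K : Type*} [Field k] [CharZero k] [IsAlgClosed k]
    [Field K] [Algebra k K]
    {D : Derivation k K K} (hD : ∀ x, D x = 0 → ∃ c : k, algebraMap k K c = x)
    {F : Submodule k K} [FiniteDimensional k F] (h1 : 1 ∈ F)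
    (hF : ∀ f ∈ F, ∀ g ∈ F, f * D g - g * D f ∈ F)
    {f : K} (hf : f ∈ F) (hf0 : f ≠ 0) {a : k} (ha : a ≠ 0) (hDf : D f = a • f) :
    F ≤ Submodule.span k {1, f, f⁻¹} := by
  have hDF : ∀ x ∈ F, D x ∈ F := fun x hx ↦ by simpa using hF 1 h1 x hx
  have htr : ∀ {h : K}, D h ≠ 0 → Transcendental k h := fun {h} hh halg ↦
    hh (D.apply_eq_zero_of_isAlgebraic halg)
  have hne : ∀ {h : K} {b : k}, h ≠ 0 → b ≠ 0 → D h = b • h → D h ≠ 0 := fun hh hb e ↦ by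
    rw [e]; exact smul_ne_zero hb hh
  have hsq : ∀ {h : K} {b : k}, h ∈ F → h ≠ 0 → b ≠ 0 → D h = b • h → h * h ∉ F := by
    intro h b hh hh0 hb e hmem
    obtain ⟨n, hn⟩ := exists_eigenvalue_eq_of_bracket_mem (b := 2 * b) hF hh hmem
      (htr (hne hh0 hb e)) (mul_ne_zero hh0 hh0) e (by
        rw [D.leibniz, e, two_mul, add_smul]
        simp only [smul_eq_mul]
        simp only [Algebra.smul_def]
        ring)
    have h2 : ((n + 1 : ℕ) : k) = 0 := by
      push_cast
      apply mul_right_cancel₀ hb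
      linear_combination hn
    exact Nat.succ_ne_zero n (Nat.cast_eq_zero.mp h2)
  have hjordan : ∀ {g h : K} {b : k}, g ∈ F → b ≠ 0 → D h = b • h → D g = b • g + h → h = 0 := by
    intro g h b hg hb eh eg
    by_contra h0
    have hh : h ∈ F := by
      rw [show h = D g - b • g by rw [eg]; abel]
      exact F.sub_mem (hDF g hg) (F.smul_mem b hg)
    refine hsq hh h0 hb eh ?_
    have := hF h hh g hg
    rwa [show h * D g - g * D h = h * h by
      rw [eg, eh]; simp only [Algebra.smul_def]; ring] at this
  have hone : ∀ g ∈ F, D g ≠ 1 := by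
    intro g hg e
    have hmem := hF g hg f hf
    have h0 := hjordan (h := a • f) hmem ha (by rw [D.map_smul, hDf]) (by
      simp only [map_sub, D.leibniz, hDf, D.map_smul, e, smul_eq_mul, D.map_one_eq_zero]
      simp only [Algebra.smul_def]
      ring)
    exact smul_ne_zero ha hf0 h0
  refine Submodule.le_of_stable_genEigenspaces (D : K →ₗ[k] K) F _ hDF (fun _ ↦ 1) ?_ ?_
  · intro b g hg h2
    by_contra hne0
    rw [pow_one] at hne0
    rw [pow_succ, pow_one, Module.End.mul_apply] at h2
    simp only [LinearMap.sub_apply, LinearMap.smul_apply, Module.End.one_apply,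
      Derivation.coeFn_coe] at h2 hne0
    by_cases hb : b = 0
    · subst hb
      simp only [zero_smul, sub_zero] at h2 hne0
      obtain ⟨c, hc⟩ := hD _ h2
      have hc0 : c ≠ 0 := by rintro rfl; exact hne0 (by rw [← hc, map_zero])
      refine hone (c⁻¹ • g) (F.smul_mem _ hg) ?_
      rw [D.map_smul, ← hc, Algebra.smul_def, ← map_mul, inv_mul_cancel₀ hc0, map_one]
    · exact hne0 (hjordan hg hb (sub_eq_zero.mp h2) (by abel))
  · intro b g hg h
    rw [pow_one] at h
    simp only [LinearMap.sub_apply, LinearMap.smul_apply, Module.End.one_apply,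
      Derivation.coeFn_coe, sub_eq_zero] at h
    by_cases hg0 : g = 0
    · rw [hg0]; exact Submodule.zero_mem _
    have hspan : ∀ (c : k) (y : K), y ∈ ({1, f, f⁻¹} : Set K) → g = algebraMap k K c * y →
        g ∈ Submodule.span k {1, f, f⁻¹} := fun c y hy e ↦ by
      rw [e, ← Algebra.smul_def]
      exact Submodule.smul_mem _ _ (Submodule.subset_span hy)
    by_cases hb : b = 0
    · obtain ⟨c, hc⟩ := hD g (by rw [h, hb, zero_smul])
      exact hspan c 1 (by simp) (by rw [hc, mul_one])
    obtain ⟨m, hm⟩ := exists_eigenvalue_eq_of_bracket_mem hF hf hg (htr (hne hf0 ha hDf)) hg0 hDf h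
    obtain ⟨n, hn⟩ := exists_eigenvalue_eq_of_bracket_mem hF hg hf (htr (hne hg0 hb h)) hf0 h hDf
    have hmn : (1 - m : ℤ) * (1 - n) = 1 := by
      have : ((1 - m : k) * (1 - n)) = 1 := by
        apply mul_right_cancel₀ ha
        rw [hm] at hn
        linear_combination -hn
      exact_mod_cast this
    rcases Int.eq_one_or_neg_one_of_mul_eq_one hmn with h' | h'
    · have hba : b = a := by
        rw [hm, show (1 - m : k) = ((1 - m : ℤ) : k) by push_cast; rfl, h']; simp
      obtain ⟨c, hc⟩ := hD (g * f⁻¹) (by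
        rw [D.leibniz, D.leibniz_inv, h, hDf, hba]
        simp only [smul_eq_mul]
        simp only [Algebra.smul_def]
        field_simp
        ring)
      exact hspan c f (by simp) (by rw [hc]; field_simp)
    · have hba : b = -a := by
        rw [hm, show (1 - m : k) = ((1 - m : ℤ) : k) by push_cast; rfl, h']; simp
      obtain ⟨c, hc⟩ := hD (g * f) (by
        rw [D.leibniz, h, hDf, hba]
        simp only [smul_eq_mul]
        simp only [Algebra.smul_def, map_neg]
        ring)
      exact hspan c f⁻¹ (by simp) (by rw [hc]; field_simp)

/-- If `F • D` is a finite-dimensional Lie algebra containing `D`, not reduced to constant multiples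
of `D`, and `D` has no nonzero eigenvalue on `F`, then `F` consists of polynomials of degree at
most two in some `f` with `D f = 1`. -/
theorem exists_le_span_of_no_eigenvector {k K : Type*} [Field k] [CharZero k] [IsAlgClosed k]
    [Field K] [Algebra k K]
    {D : Derivation k K K} (hD : ∀ x, D x = 0 → ∃ c : k, algebraMap k K c = x)
    {F : Submodule k K} [FiniteDimensional k F] (h1 : 1 ∈ F)
    (hF : ∀ f ∈ F, ∀ g ∈ F, f * D g - g * D f ∈ F)
    (hne : ∃ g ∈ F, D g ≠ 0)
    (heig : ∀ f ∈ F, ∀ a : k, a ≠ 0 → D f = a • f → f = 0) :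
    ∃ f : K, D f = 1 ∧ F ≤ Submodule.span k {1, f, f ^ 2} := by
  have hDF : ∀ x ∈ F, D x ∈ F := fun x hx ↦ by simpa using hF 1 h1 x hx
  have hnil : ∀ (n : ℕ) (P : Submodule k K),
      (∀ x ∈ F, ((D : K →ₗ[k] K) ^ (n + 1)) x = 0 → ((D : K →ₗ[k] K) ^ n) x = 0) →
      (∀ x ∈ F, ((D : K →ₗ[k] K) ^ n) x = 0 → x ∈ P) → F ≤ P := by
    classical
    intro n P hst hP
    refine Submodule.le_of_stable_genEigenspaces (D : K →ₗ[k] K) F P hDF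
      (fun b ↦ if b = 0 then n else 0) (fun b x hx h ↦ ?_) (fun b x hx h ↦ ?_)
    · by_cases hb : b = 0
      · simp only [hb, if_true, zero_smul, sub_zero] at h ⊢
        exact hst x hx h
      · simp only [hb, if_false, zero_add, pow_one, pow_zero, LinearMap.sub_apply,
          LinearMap.smul_apply, Module.End.one_apply, Derivation.coeFn_coe, sub_eq_zero] at h ⊢
        exact heig x hx b hb h
    · by_cases hb : b = 0
      · simp only [hb, if_true, zero_smul, sub_zero] at h
        exact hP x hx h
      · simp only [hb, if_false, pow_zero, Module.End.one_apply] at h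
        rw [h]; exact P.zero_mem
  have hDpow : ∀ (n : ℕ) (x : K), ((D : K →ₗ[k] K) ^ (n + 1)) x = ((D : K →ₗ[k] K) ^ n) (D x) :=
    fun n x ↦ by rw [pow_succ, Module.End.mul_apply, Derivation.coeFn_coe]
  obtain ⟨f, hf, hDf⟩ : ∃ f ∈ F, D f = 1 := by
    by_contra! hno
    obtain ⟨g, hg, hDg⟩ := hne
    refine hDg (hnil 1 (LinearMap.ker (D : K →ₗ[k] K)) (fun x hx h ↦ ?_) (fun x hx h ↦ ?_) hg)
    · simp only [hDpow, pow_zero, Module.End.one_apply] at h ⊢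
      by_contra h0
      obtain ⟨c, hc⟩ := hD _ h
      have hc0 : c ≠ 0 := by rintro rfl; exact h0 (by rw [← hc, map_zero])
      refine hno (c⁻¹ • x) (F.smul_mem _ hx) ?_
      rw [D.map_smul, ← hc, Algebra.smul_def, ← map_mul, inv_mul_cancel₀ hc0, map_one]
    · simpa [hDpow] using h
  have htr : Transcendental k f := fun halg ↦ by
    have := D.apply_eq_zero_of_isAlgebraic halg
    rw [hDf] at this
    exact one_ne_zero this
  have hDfpow : ∀ n : ℕ, D (f ^ (n + 1)) = ((n + 1 : ℕ) : k) • f ^ n := fun n ↦ by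
    rw [D.leibniz_pow, hDf, Nat.add_sub_cancel, smul_eq_mul, mul_one, Nat.cast_smul_eq_nsmul]
  have hint : ∀ x y : K, D x = D y → ∃ c : k, x = y + algebraMap k K c := fun x y h ↦ by
    obtain ⟨c, hc⟩ := hD (x - y) (by rw [map_sub, h, sub_self])
    exact ⟨c, by rw [hc]; ring⟩
  have : CharZero K := charZero_of_injective_algebraMap (algebraMap k K).injective
  have hquad : ∀ x : K, D (D (D x)) = 0 → ∃ a b c : k, x = a • f ^ 2 + b • f + c • (1 : K) := by
    intro x hx
    obtain ⟨a, ha⟩ := hD _ hx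
    obtain ⟨b, hb⟩ := hint (D x) (a • f) (by rw [D.map_smul, hDf, ← ha, Algebra.smul_def, mul_one])
    obtain ⟨c, hc⟩ := hint x ((a / 2) • f ^ 2 + b • f) (by
      rw [hb, map_add, D.map_smul, D.map_smul, hDfpow 1, hDf, smul_smul]
      simp [Algebra.smul_def])
    exact ⟨a / 2, b, c, by rw [hc, Algebra.smul_def c, mul_one]⟩
  refine ⟨f, hDf, hnil 3 _ (fun x hx h ↦ ?_) (fun x hx h ↦ ?_)⟩
  · simp only [hDpow, pow_zero, Module.End.one_apply] at h ⊢
    by_contra h0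
    obtain ⟨a, ha⟩ := hD _ h
    have ha0 : a ≠ 0 := by rintro rfl; exact h0 (by rw [← ha, map_zero])
    have hmem2 : f ^ 2 ∈ F := by
      obtain ⟨p, q, r, e⟩ := hquad (D x) h
      have hp : p ≠ 0 := by
        rintro rfl
        refine h0 ?_
        rw [e]
        simp [hDf]
      rw [← F.smul_mem_iff hp, show p • f ^ 2 = D x - q • f - r • (1 : K) by rw [e]; abel]
      exact F.sub_mem (F.sub_mem (hDF x hx) (F.smul_mem _ hf)) (F.smul_mem _ h1)
    have hmem3 : f ^ 3 ∈ F := by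
      obtain ⟨p, q, r, e⟩ := hquad (x - (a / 6) • f ^ 3) (by
        simp only [map_sub, D.map_smul, hDfpow 2, hDfpow 1, pow_one, hDf, ← ha]
        simp only [Algebra.smul_def, map_div₀, map_ofNat, map_natCast]
        push_cast
        ring)
      rw [← F.smul_mem_iff (div_ne_zero ha0 (by norm_num : (6 : k) ≠ 0)),
        show (a / 6) • f ^ 3 = x - (p • f ^ 2 + q • f + r • (1 : K)) by rw [← e]; abel]
      exact F.sub_mem hx
        (F.add_mem (F.add_mem (F.smul_mem _ hmem2) (F.smul_mem _ hf)) (F.smul_mem _ h1))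
    have hf0 : f ≠ 0 := by rintro rfl; simp at hDf
    obtain ⟨n, hn⟩ := F.exists_mul_pow_notMem htr (pow_ne_zero 3 hf0)
    refine hn ?_
    clear hn
    induction n with
    | zero => simpa using hmem3
    | succ n ih =>
      have hbr := hF _ hmem2 _ ih
      rw [show f ^ 2 * D (f ^ 3 * f ^ n) - f ^ 3 * f ^ n * D (f ^ 2)
          = ((n + 1 : ℕ) : k) • (f ^ 3 * f ^ (n + 1)) by
        rw [← pow_add, show 3 + n = n + 2 + 1 by ring, hDfpow, hDfpow 1]
        simp only [Algebra.smul_def, map_natCast]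
        push_cast
        ring] at hbr
      exact (F.smul_mem_iff (Nat.cast_ne_zero.mpr n.succ_ne_zero)).mp hbr
  · simp only [hDpow, pow_zero, Module.End.one_apply] at h
    obtain ⟨a, b, c, rfl⟩ := hquad x h
    refine Submodule.add_mem _ (Submodule.add_mem _ ?_ ?_) ?_ <;>
      exact Submodule.smul_mem _ _ (Submodule.subset_span (by simp))

/-- Lie's theorem for curves: a finite-dimensional Lie algebra of rational vector
fields of dimension at least `2` on a curve is conjugated into (a subalgebra of) the
pull-back of `𝔰𝔩₂` acting on `ℙ¹`: there is a transcendental `φ ∈ K` with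
`v(φ) ∈ span ℂ {1, φ, φ²}` for every `v ∈ 𝔤`. -/
theorem lie_algebra_on_curve_projective
    (K : Type*) [Field K] [Algebra ℂ K]
    -- `K` is a finitely generated field extension of `ℂ` ...
    (hfg : ∃ s : Finset K, IntermediateField.adjoin ℂ (s : Set K) = ⊤)
    -- ... of transcendence degree one:
    (t : K) (ht : Transcendental ℂ t)
    (halg : Algebra.IsAlgebraic (IntermediateField.adjoin ℂ ({t} : Set K)) K)
    (𝔤 : LieSubalgebra ℂ (Derivation ℂ K K))
    (hfd : FiniteDimensional ℂ ↥𝔤)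
    (hdim : 2 ≤ Module.finrank ℂ ↥𝔤) :
    ∃ φ : K, Transcendental ℂ φ ∧
      ∀ v ∈ 𝔤, v φ ∈ Submodule.span ℂ ({1, φ, φ ^ 2} : Set K) := by
  have htr : ∀ (D : Derivation ℂ K K) {x : K}, D x ≠ 0 → Transcendental ℂ x := fun D x hx h ↦
    hx (D.apply_eq_zero_of_isAlgebraic h)
  have : Nontrivial 𝔤 := Module.nontrivial_of_finrank_pos (R := ℂ) (by omega)
  obtain ⟨⟨D, hDg⟩, hD0⟩ := exists_ne (0 : 𝔤)
  replace hD0 : D ≠ 0 := fun h ↦ hD0 (Subtype.ext h)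
  have hconst : ∀ x, D x = 0 → ∃ c : ℂ, algebraMap ℂ K c = x := fun x hx ↦
    IsAlgClosed.exists_algebraMap_eq (Derivation.isAlgebraic_of_apply_eq_zero ht halg hD0 hx)
  have hDt : D t ≠ 0 := fun h ↦ ht (Derivation.isAlgebraic_of_apply_eq_zero ht halg hD0 h)
  have hmul : ∀ w : Derivation ℂ K K, ∃ f : K, w = f • D := fun w ↦ by
    refine ⟨w t / D t, Derivation.ext fun a ↦ sub_eq_zero.mp ?_⟩
    exact (w - (w t / D t) • D).apply_eq_zero_of_isAlgebraic_adjoin (x := t)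
      (by simp [div_mul_cancel₀ _ hDt]) (halg.isAlgebraic a)
  let toDer : K →ₗ[ℂ] Derivation ℂ K K := (LinearMap.toSpanSingleton K _ D).restrictScalars ℂ
  have htoDer : ∀ f, toDer f = f • D := fun _ ↦ rfl
  have hinj : Function.Injective toDer := fun f g h ↦ by
    have := congrArg (fun w : Derivation ℂ K K ↦ w t) h
    simpa [htoDer, hDt] using this
  let F : Submodule ℂ K := 𝔤.toSubmodule.comap toDer
  have hmemF : ∀ f, f ∈ F ↔ f • D ∈ 𝔤 := fun _ ↦ Iff.rfl
  have : FiniteDimensional ℂ F := by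
    let i : F →ₗ[ℂ] 𝔤.toSubmodule := toDer.restrict fun _ h ↦ h
    have : FiniteDimensional ℂ 𝔤.toSubmodule := hfd
    exact FiniteDimensional.of_injective i fun x y h ↦
      Subtype.ext (hinj (congrArg Subtype.val h))
  have h1 : (1 : K) ∈ F := by rwa [hmemF, one_smul]
  have hbr : ∀ f ∈ F, ∀ g ∈ F, f * D g - g * D f ∈ F := fun f hf g hg ↦ by
    rw [hmemF] at hf hg ⊢
    convert 𝔤.lie_mem hf hg using 1
    ext a
    simp only [Derivation.commutator_apply, Derivation.smul_apply, smul_eq_mul, D.leibniz]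
    ring
  have hne : ∃ g ∈ F, D g ≠ 0 := by
    by_contra! hall
    have hle : ∀ w : 𝔤, ∃ c : ℂ, c • (⟨D, hDg⟩ : 𝔤) = w := by
      rintro ⟨w, hw⟩
      obtain ⟨f, rfl⟩ := hmul w
      obtain ⟨c, rfl⟩ := hconst f (hall f hw)
      exact ⟨c, Subtype.ext (algebraMap_smul K c D).symm⟩
    have := finrank_le_one (⟨D, hDg⟩ : 𝔤) hle
    omega
  suffices ∃ φ : K, D φ ≠ 0 ∧ ∀ g ∈ F, g * D φ ∈ Submodule.span ℂ ({1, φ, φ ^ 2} : Set K) by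
    obtain ⟨φ, hφ, hspan⟩ := this
    refine ⟨φ, htr D hφ, fun w hw ↦ ?_⟩
    obtain ⟨g, rfl⟩ := hmul w
    exact hspan g hw
  by_cases heig : ∀ f ∈ F, ∀ a : ℂ, a ≠ 0 → D f = a • f → f = 0
  · obtain ⟨f, hDf, hle⟩ := exists_le_span_of_no_eigenvector hconst h1 hbr hne heig
    exact ⟨f, by simp [hDf], fun g hg ↦ by rw [hDf, mul_one]; exact hle hg⟩
  · push Not at heig
    obtain ⟨f, hf, a, ha, hDf, hf0⟩ := heig
    refine ⟨f, by rw [hDf]; exact smul_ne_zero ha hf0, fun g hg ↦ ?_⟩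
    have hg' := le_span_of_eigenvector hconst h1 hbr hf hf0 ha hDf hg
    obtain ⟨p, q, r, rfl⟩ := Submodule.mem_span_triple.mp hg'
    refine Submodule.mem_span_triple.mpr ⟨a * r, a * p, a * q, ?_⟩
    rw [hDf]
    simp only [Algebra.smul_def, map_mul]
    field_simp
    ring
end

section
/- (Morozov) Let 𝔤 be a finite-dimensional Lie algebra over ℂ and 𝔥 ⊊ 𝔤 a proper Lie subalgebra such that (𝔤,𝔥) is an effective primitive pair: 𝔥 is maximal among proper Lie subalgebras of 𝔤 and 𝔥 contains no nonzero Lie ideal of 𝔤. Then at least one of the following holds: (1) 𝔤 is a simple Lie algebra; (2) there exist Lie ideals 𝔩₁, 𝔩₂ of 𝔤, each simple as a Lie algebra and isomorphic to each other, with 𝔩₁ ∩ 𝔩₂ = 0 and 𝔩₁ + 𝔩₂ = 𝔤, such that 𝔥 ∩ 𝔩₁ = 𝔥 ∩ 𝔩₂ = 0 and the projection of 𝔤 onto each factor 𝔩ᵢ restricts to an isomorphism on 𝔥 (i.e. 𝔥 is a diagonal subalgebra); or (3) there exists an abelian Lie ideal 𝔪 of 𝔤 with 𝔥 ∩ 𝔪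 = 0 and 𝔥 + 𝔪 = 𝔤 (so 𝔤 = 𝔥 ⋉ 𝔪), such that 𝔪 is an irreducible and faithful 𝔥-module under the adjoint action, and 𝔥 is the direct sum of a semisimple Lie ideal and an abelian ideal of dimension at most 1. -/
namespace LieAlgebra

open LieModule Module

/-- In a reductive Lie algebra, an ideal complementary to the center has trivial radical. -/
lemma hasTrivialRadical_of_isCompl_center {K H : Type*} [Field K] [LieRing H] [LieAlgebra K H]
    [FiniteDimensional K H] [HasCentralRadical K H] (s : LieIdeal K H)
    (hinf : s ⊓ center K H = ⊥) (hsup : s ⊔ center K H = ⊤) : HasTrivialRadical K s := by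
  rw [hasTrivialRadical_iff_no_abelian_ideals]
  intro I hI
  let J : LieIdeal K H :=
    { I.toSubmodule.map s.toSubmodule.subtype with
      lie_mem := by
        rintro x _ ⟨y, hy, rfl⟩
        obtain ⟨a, ha, b, hb, rfl⟩ :=
          (LieSubmodule.mem_sup _ _ _).mp (hsup ▸ LieSubmodule.mem_top x)
        have hby : ⁅b, (y : H)⁆ = 0 := by
          rw [← lie_skew, (mem_maxTrivSubmodule K H H b).mp hb, neg_zero]
        refine ⟨⁅(⟨a, ha⟩ : s), y⁆, lie_mem_right K s I ⟨a, ha⟩ y hy, ?_⟩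
        change ⁅a, (y : H)⁆ = ⁅a + b, (y : H)⁆
        rw [add_lie, hby, add_zero] }
  have hJ : IsLieAbelian J := by
    refine ⟨?_⟩
    rintro ⟨_, x, hx, rfl⟩ ⟨_, y, hy, rfl⟩
    have := congrArg (fun z : I ↦ ((z : s) : H)) (hI.trivial ⟨x, hx⟩ ⟨y, hy⟩)
    exact Subtype.ext this
  have hJc : J ≤ center K H := by
    rw [← radical_eq_center (R := K) (L := H), ← LieIdeal.solvable_iff_le_radical]
    exact ofAbelianIsSolvable J
  rw [LieSubmodule.eq_bot_iff]
  intro x hx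
  have : (x : H) ∈ s ⊓ center K H := ⟨x.2, hJc ⟨x, hx, rfl⟩⟩
  rw [hinf, LieSubmodule.mem_bot] at this
  exact Subtype.ext this

/-- A Lie algebra with a faithful irreducible representation is the direct sum of a semisimple
ideal and an abelian ideal of dimension at most one. -/
lemma exists_isSemisimple_isLieAbelian_of_isIrreducible_of_isFaithful
    (K H M : Type*) [Field K] [CharZero K] [LieRing H] [LieAlgebra K H] [FiniteDimensional K H]
    [AddCommGroup M] [Module K M] [LieRingModule H M] [LieModule K H M] [FiniteDimensional K M]
    [IsIrreducible K H M] [IsFaithful K H M] [IsTriangularizable K H M] :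
    ∃ s a : LieIdeal K H, IsSemisimple K s ∧ IsLieAbelian a ∧ finrank K a ≤ 1 ∧
      s ⊓ a = ⊥ ∧ s ⊔ a = ⊤ := by
  obtain ⟨_, hc⟩ := hasCentralRadical_and_of_isIrreducible_of_isFaithful K H M
  suffices ∃ s : LieIdeal K H, s ⊓ center K H = ⊥ ∧ s ⊔ center K H = ⊤ ∧
      finrank K (center K H) ≤ 1 by
    obtain ⟨s, hinf, hsup, hfr⟩ := this
    have := hasTrivialRadical_of_isCompl_center s hinf hsup
    exact ⟨s, center K H, inferInstance, inferInstance, hfr, hinf, hsup⟩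
  by_cases hbot : center K H = ⊥
  · refine ⟨⊤, by simp [hbot], by simp, ?_⟩
    rw [hbot]
    exact finrank_zero_of_subsingleton.le.trans zero_le_one
  have hM : (finrank K M : K) ≠ 0 := by
    have := nontrivial_of_isIrreducible K H M
    exact_mod_cast finrank_pos.ne'
  obtain ⟨z, hz, hz0⟩ : ∃ z ∈ center K H, z ≠ 0 := by
    simpa [LieSubmodule.eq_bot_iff] using hbot
  let τ : H →ₗ[K] K := LinearMap.trace K M ∘ₗ (toEnd K H M : H →ₗ[K] End K M)
  have hτ (x : H) : τ x = LinearMap.trace K M (toEnd K H M x) := rfl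
  have hker (x : H) (hx : x ∈ center K H) (hx0 : τ x = 0) : x = 0 := by
    obtain ⟨t, ht⟩ := Submodule.mem_span_singleton.mp ((hc x).mp hx)
    rw [hτ, ← ht, map_smul, LinearMap.trace_id, smul_eq_mul] at hx0
    have ht0 : t = 0 := (mul_eq_zero.mp hx0).resolve_right hM
    rw [← toEnd_eq_zero_iff (R := K) (L := H) (M := M), ← ht, ht0, zero_smul]
  have hz1 : τ z ≠ 0 := fun h ↦ hz0 (hker z hz h)
  have hsub (x : H) : τ (x - (τ x / τ z) • z) = 0 := by
    rw [map_sub, map_smul, smul_eq_mul, div_mul_cancel₀ _ hz1, sub_self]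
  let s : LieIdeal K H := { LinearMap.ker τ with lie_mem := by intro x m _; simp [hτ] }
  have hs (x : H) : x ∈ s ↔ τ x = 0 := Iff.rfl
  refine ⟨s, ?_, ?_, ?_⟩
  · rw [LieSubmodule.eq_bot_iff]
    exact fun x hx ↦ hker x hx.2 hx.1
  · rw [eq_top_iff]
    intro x _
    exact (LieSubmodule.mem_sup _ _ _).mpr
      ⟨_, (hs _).mpr (hsub x), (τ x / τ z) • z, (center K H).smul_mem _ hz, by abel⟩
  · refine finrank_le_one (⟨z, hz⟩ : center K H) fun w ↦ ⟨τ w / τ z, Subtype.ext ?_⟩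
    exact (sub_eq_zero.mp (hker _ ((center K H).sub_mem w.2 ((center K H).smul_mem _ hz))
      (hsub w))).symm

end LieAlgebra

/-- A subalgebra complementary to an ideal is isomorphic to the quotient by that ideal. -/
lemma LieSubalgebra.nonempty_equiv_quotient {R L : Type*} [CommRing R] [LieRing L]
    [LieAlgebra R L] (A : LieSubalgebra R L) (I : LieIdeal R L) (hinf : ∀ x ∈ A, x ∈ I → x = 0)
    (hsup : ∀ g : L, ∃ x ∈ A, g - x ∈ I) : Nonempty (A ≃ₗ⁅R⁆ L ⧸ I) := by
  let f : A →ₗ⁅R⁆ L ⧸ I :=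
    { (LieSubmodule.Quotient.mk' I : L →ₗ[R] L ⧸ I) ∘ₗ A.toSubmodule.subtype with
      map_lie' := fun {_ _} ↦ rfl }
  refine ⟨LieEquiv.ofBijective f ⟨?_, ?_⟩⟩
  · refine (injective_iff_map_eq_zero f).mpr fun x hx ↦ Subtype.ext (hinf x x.2 ?_)
    exact LieSubmodule.Quotient.mk_eq_zero'.mp hx
  · intro q
    obtain ⟨g, rfl⟩ := LieSubmodule.Quotient.surjective_mk' I q
    obtain ⟨x, hx, hgx⟩ := hsup g
    refine ⟨⟨x, hx⟩, ?_⟩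
    rw [← neg_mem_iff, neg_sub] at hgx
    exact (Submodule.Quotient.eq _).mpr hgx

/-- A maximal subalgebra containing no nonzero ideal is supplemented by every nonzero ideal. -/
lemma LieSubalgebra.exists_sub_mem_of_maximal {R L : Type*} [CommRing R] [LieRing L]
    [LieAlgebra R L] {𝔥 : LieSubalgebra R L}
    (hmax : ∀ 𝔩 : LieSubalgebra R L, 𝔥 ≤ 𝔩 → 𝔩 = 𝔥 ∨ 𝔩 = ⊤)
    (heff : ∀ 𝔨 : LieIdeal R L, (∀ x ∈ 𝔨, x ∈ 𝔥) → 𝔨 = ⊥)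
    {I : LieIdeal R L} (hI : I ≠ ⊥) (g : L) : ∃ x ∈ 𝔥, g - x ∈ I := by
  let S : LieSubalgebra R L :=
    { 𝔥.toSubmodule ⊔ I.toSubmodule with
      lie_mem' := by
        intro x y hx hy
        obtain ⟨a, ha, i, hi, rfl⟩ := Submodule.mem_sup.mp hx
        obtain ⟨b, hb, j, hj, rfl⟩ := Submodule.mem_sup.mp hy
        refine Submodule.mem_sup.mpr ⟨⁅a, b⁆, 𝔥.lie_mem ha hb, ⁅a, j⁆ + ⁅i, b + j⁆,
          I.add_mem (lie_mem_right R L I a j hj) (lie_mem_left R L I i _ hi), ?_⟩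
        simp only [lie_add, add_lie]
        abel }
  have hS : S = ⊤ := by
    refine (hmax S (le_sup_left (a := 𝔥.toSubmodule))).resolve_left fun h ↦ hI (heff I ?_)
    intro x hx
    rw [← h]
    exact (le_sup_right (a := 𝔥.toSubmodule)) hx
  have hg : g ∈ S := hS ▸ LieSubalgebra.mem_top g
  obtain ⟨x, hx, i, hi, rfl⟩ := Submodule.mem_sup.mp hg
  exact ⟨x, hx, by simpa using hi⟩

/-- A subspace of `𝔥` normalized by `𝔥` and by a complementary ideal vanishes. -/
lemma LieSubalgebra.eq_bot_of_lie_mem {R L : Type*} [CommRing R] [LieRing L]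
    [LieAlgebra R L] {𝔥 : LieSubalgebra R L}
    (heff : ∀ 𝔨 : LieIdeal R L, (∀ x ∈ 𝔨, x ∈ 𝔥) → 𝔨 = ⊥)
    {I : LieIdeal R L} (hsup : ∀ g : L, ∃ x ∈ 𝔥, g - x ∈ I) {p : Submodule R L}
    (hp : p ≤ 𝔥.toSubmodule) (h𝔥 : ∀ x ∈ 𝔥, ∀ y ∈ p, ⁅x, y⁆ ∈ p)
    (hI : ∀ x ∈ I, ∀ y ∈ p, ⁅x, y⁆ = 0) : p = ⊥ := by
  let P : LieIdeal R L :=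
    { p with
      lie_mem := by
        intro g y hy
        obtain ⟨x, hx, hgx⟩ := hsup g
        rw [← sub_add_cancel g x, add_lie, hI _ hgx y hy, zero_add]
        exact h𝔥 x hx y hy }
  have := heff P hp
  exact congrArg LieSubmodule.toSubmodule this

open LieAlgebra in
/-- Morozov's structure theorem for effective primitive pairs `(𝔤, 𝔥)`. -/
theorem morozov_structure_theorem
    (L : Type*) [LieRing L] [LieAlgebra ℂ L] [FiniteDimensional ℂ L]
    (𝔥 : LieSubalgebra ℂ L)
    (hmax : 𝔥 ≠ ⊤ ∧ ∀ 𝔩 : LieSubalgebra ℂ L, 𝔥 ≤ 𝔩 → 𝔩 = 𝔥 ∨ 𝔩 = ⊤)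
    (heff : ∀ 𝔨 : LieIdeal ℂ L, (∀ x ∈ 𝔨, x ∈ 𝔥) → 𝔨 = ⊥) :
    -- (1) `𝔤` is simple, or
    LieAlgebra.IsSimple ℂ L ∨
    -- (2) `𝔤 = 𝔩₁ ⊕ 𝔩₂` with `𝔩₁ ≃ 𝔩₂` simple and `𝔥` a diagonal subalgebra, or
    (∃ 𝔩₁ 𝔩₂ : LieIdeal ℂ L,
      LieAlgebra.IsSimple ℂ ↥𝔩₁ ∧ LieAlgebra.IsSimple ℂ ↥𝔩₂ ∧
      Nonempty (↥𝔩₁ ≃ₗ⁅ℂ⁆ ↥𝔩₂) ∧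
      𝔩₁ ⊓ 𝔩₂ = ⊥ ∧ 𝔩₁ ⊔ 𝔩₂ = ⊤ ∧
      (∀ x : L, x ∈ 𝔥 → x ∈ 𝔩₁ → x = 0) ∧
      (∀ x : L, x ∈ 𝔥 → x ∈ 𝔩₂ → x = 0) ∧
      -- the projection onto each factor restricts to an isomorphism on `𝔥`:
      (∀ y ∈ 𝔩₁, ∃ x ∈ 𝔥, x - y ∈ 𝔩₂) ∧
      (∀ y ∈ 𝔩₂, ∃ x ∈ 𝔥, x - y ∈ 𝔩₁)) ∨
    -- (3) `𝔤 = 𝔥 ⋉ 𝔪` of affine type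
    (∃ 𝔪 : LieIdeal ℂ L,
      IsLieAbelian ↥𝔪 ∧
      (∀ x : L, x ∈ 𝔥 → x ∈ 𝔪 → x = 0) ∧
      (∀ g : L, ∃ x ∈ 𝔥, g - x ∈ 𝔪) ∧
      -- `𝔪` is an irreducible `𝔥`-module ...
      (𝔪 ≠ ⊥) ∧
      (∀ p : Submodule ℂ L, (∀ x ∈ p, x ∈ 𝔪) →
        (∀ h ∈ 𝔥, ∀ x ∈ p, ⁅h, x⁆ ∈ p) → p = ⊥ ∨ ∀ x ∈ 𝔪, x ∈ p) ∧
      -- ... and a faithful one: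
      (∀ h ∈ 𝔥, (∀ x ∈ 𝔪, ⁅h, x⁆ = 0) → h = 0) ∧
      -- `𝔥` is the direct sum of a semisimple ideal and an abelian ideal of dim ≤ 1:
      (∃ s a : LieIdeal ℂ ↥𝔥,
        LieAlgebra.IsSemisimple ℂ ↥s ∧ IsLieAbelian ↥a ∧
        Module.finrank ℂ ↥a ≤ 1 ∧ s ⊓ a = ⊥ ∧ s ⊔ a = ⊤)) := by
  have hsupp {I : LieIdeal ℂ L} (hI : I ≠ ⊥) (g : L) : ∃ x ∈ 𝔥, g - x ∈ I :=
    LieSubalgebra.exists_sub_mem_of_maximal hmax.2 heff hI g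
  -- an ideal meeting `𝔥` trivially contains no smaller nonzero ideal
  have hmin {I J : LieIdeal ℂ L} (hI : ∀ x ∈ 𝔥, x ∈ I → x = 0) (hJI : J ≤ I) (hJ : J ≠ ⊥) :
      I ≤ J := by
    intro y hy
    obtain ⟨x, hx, hyx⟩ := hsupp hJ y
    have hx0 : x = 0 := hI x hx (by simpa using I.sub_mem hy (hJI hyx))
    simpa [hx0] using hyx
  -- an ideal commuting with a nonzero ideal meets `𝔥` trivially
  have hdisj {I J : LieIdeal ℂ L} (hJ : J ≠ ⊥) (hIJ : ∀ x ∈ J, ∀ y ∈ I, ⁅x, y⁆ = 0) :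
      ∀ x ∈ 𝔥, x ∈ I → x = 0 := by
    have := LieSubalgebra.eq_bot_of_lie_mem heff (hsupp hJ) (p := 𝔥.toSubmodule ⊓ I.toSubmodule)
      inf_le_left (fun x hx y hy ↦ ⟨𝔥.lie_mem hx hy.1, lie_mem_right ℂ L I x y hy.2⟩)
      (fun x hx y hy ↦ hIJ x hx y hy.2)
    exact fun x hx hxI ↦ (Submodule.eq_bot_iff _).mp this x ⟨hx, hxI⟩
  by_cases hrad : HasTrivialRadical ℂ L
  · have hL : (⊤ : LieIdeal ℂ L) ≠ ⊥ := by
      intro h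
      refine hmax.1 (eq_top_iff.mpr fun x _ ↦ ?_)
      have hx : x ∈ (⊤ : LieIdeal ℂ L) := LieSubmodule.mem_top x
      rw [h, LieSubmodule.mem_bot] at hx
      exact hx ▸ 𝔥.zero_mem
    obtain ⟨𝔩₁, hatom, -⟩ := (eq_bot_or_exists_atom_le (⊤ : LieIdeal ℂ L)).resolve_left hL
    by_cases htop : 𝔩₁ = ⊤
    · subst htop
      refine Or.inl ⟨fun I ↦ (hatom.le_iff.mp le_top), fun h ↦ ?_⟩
      have := subsingleton_of_hasTrivialRadical_lie_abelian ℂ L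
      exact hL (Subsingleton.elim _ _)
    refine Or.inr (Or.inl ?_)
    obtain ⟨𝔩₂, hcompl⟩ := exists_isCompl 𝔩₁
    have hinf : 𝔩₁ ⊓ 𝔩₂ = ⊥ := hcompl.inf_eq_bot
    have hsup : 𝔩₁ ⊔ 𝔩₂ = ⊤ := hcompl.sup_eq_top
    have h₂ : 𝔩₂ ≠ ⊥ := by
      rintro rfl
      exact htop (by simpa using hsup)
    have hcomm (x : L) (hx : x ∈ 𝔩₁) (y : L) (hy : y ∈ 𝔩₂) : ⁅x, y⁆ = 0 := by
      have : ⁅x, y⁆ ∈ 𝔩₁ ⊓ 𝔩₂ := ⟨lie_mem_left ℂ L _ _ _ hx, lie_mem_right ℂ L _ _ _ hy⟩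
      rwa [hinf, LieSubmodule.mem_bot] at this
    have hd₂ := hdisj hatom.1 hcomm
    have hd₁ := hdisj h₂ (I := 𝔩₁) fun x hx y hy ↦ by rw [← lie_skew, hcomm y hy x hx, neg_zero]
    have hatom₂ : IsAtom 𝔩₂ := ⟨h₂, fun J hJ ↦ by_contra fun h ↦ hJ.not_ge (hmin hd₂ hJ.le h)⟩
    have hdec (g : L) : ∃ a ∈ 𝔩₁, ∃ b ∈ 𝔩₂, a + b = g :=
      (LieSubmodule.mem_sup _ _ _).mp (hsup ▸ LieSubmodule.mem_top g)
    have hz (x : L) (hx₁ : x ∈ 𝔩₁) (hx₂ : x ∈ 𝔩₂) : x = 0 := by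
      have : x ∈ 𝔩₁ ⊓ 𝔩₂ := ⟨hx₁, hx₂⟩
      rwa [hinf, LieSubmodule.mem_bot] at this
    obtain ⟨e₁⟩ := 𝔥.nonempty_equiv_quotient 𝔩₁ hd₁ (hsupp hatom.1)
    obtain ⟨e₂⟩ := 𝔥.nonempty_equiv_quotient 𝔩₂ hd₂ (hsupp h₂)
    obtain ⟨f₁⟩ := 𝔩₁.toLieSubalgebra.nonempty_equiv_quotient 𝔩₂ hz fun g ↦ by
      obtain ⟨a, ha, b, hb, rfl⟩ := hdec g
      exact ⟨a, ha, by simpa using hb⟩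
    obtain ⟨f₂⟩ := 𝔩₂.toLieSubalgebra.nonempty_equiv_quotient 𝔩₁
        (fun x h h' ↦ hz x h' h) fun g ↦ by
      obtain ⟨a, ha, b, hb, rfl⟩ := hdec g
      exact ⟨b, hb, by simpa using ha⟩
    refine ⟨𝔩₁, 𝔩₂, IsSemisimple.isSimple_of_isAtom _ hatom,
      IsSemisimple.isSimple_of_isAtom _ hatom₂,
      ⟨((f₁.trans e₂.symm).trans e₁).trans f₂.symm⟩, hinf, hsup, hd₁, hd₂,
      fun y _ ↦ ?_, fun y _ ↦ ?_⟩
    · obtain ⟨x, hx, h⟩ := hsupp h₂ y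
      exact ⟨x, hx, by rwa [← neg_sub, neg_mem_iff]⟩
    · obtain ⟨x, hx, h⟩ := hsupp hatom.1 y
      exact ⟨x, hx, by rwa [← neg_sub, neg_mem_iff]⟩
  · rw [hasTrivialRadical_iff_no_abelian_ideals] at hrad
    push Not at hrad
    obtain ⟨𝔪, hab, hne⟩ := hrad
    have hcomm (x : L) (hx : x ∈ 𝔪) (y : L) (hy : y ∈ 𝔪) : ⁅x, y⁆ = 0 :=
      congrArg Subtype.val (hab.trivial ⟨x, hx⟩ ⟨y, hy⟩)
    have hd := hdisj hne hcomm
    have hirr (p : Submodule ℂ L) (hp : ∀ x ∈ p, x ∈ 𝔪)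
        (hinv : ∀ h ∈ 𝔥, ∀ x ∈ p, ⁅h, x⁆ ∈ p) : p = ⊥ ∨ ∀ x ∈ 𝔪, x ∈ p := by
      let P : LieIdeal ℂ L :=
        { p with
          lie_mem := by
            intro g y hy
            obtain ⟨x, hx, hgx⟩ := hsupp hne g
            rw [← sub_add_cancel g x, add_lie, hcomm _ hgx y (hp y hy), zero_add]
            exact hinv x hx y hy }
      by_cases hP : P = ⊥
      · exact Or.inl (congrArg LieSubmodule.toSubmodule hP)
      · exact Or.inr fun x hx ↦ hmin (J := P) hd hp hP hx
    have hfaith (h : L) (hh : h ∈ 𝔥) (hzero : ∀ x ∈ 𝔪, ⁅h, x⁆ = 0) : h = 0 := by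
      let p : Submodule ℂ L :=
        { carrier := {h | h ∈ 𝔥 ∧ ∀ x ∈ 𝔪, ⁅h, x⁆ = 0}
          zero_mem' := ⟨𝔥.zero_mem, by simp⟩
          add_mem' := fun ha hb ↦ ⟨𝔥.add_mem ha.1 hb.1, fun x hx ↦ by
            rw [add_lie, ha.2 x hx, hb.2 x hx, add_zero]⟩
          smul_mem' := fun c a ha ↦ ⟨𝔥.smul_mem c ha.1, fun x hx ↦ by
            rw [smul_lie, ha.2 x hx, smul_zero]⟩ }
      have hp : p = ⊥ := LieSubalgebra.eq_bot_of_lie_mem heff (hsupp hne) (fun y hy ↦ hy.1)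
        (fun x hx y hy ↦ ⟨𝔥.lie_mem hx hy.1, fun m hm ↦ by
          rw [lie_lie, hy.2 m hm, hy.2 _ (lie_mem_right ℂ L 𝔪 x m hm), lie_zero, sub_zero]⟩)
        (fun x hx y hy ↦ by rw [← lie_skew, hy.2 x hx, neg_zero])
      exact (Submodule.eq_bot_iff p).mp hp h ⟨hh, hzero⟩
    have _ : Nontrivial 𝔪 := (LieSubmodule.nontrivial_iff_ne_bot ℂ L L).mpr hne
    have _ : LieModule.IsIrreducible ℂ 𝔥 𝔪 := by
      refine LieModule.IsIrreducible.mk fun N hN ↦ ?_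
      have := hirr (N.toSubmodule.map 𝔪.toSubmodule.subtype)
        (by rintro _ ⟨y, -, rfl⟩; exact y.2)
        (by
          rintro h hh _ ⟨y, hy, rfl⟩
          exact ⟨_, N.lie_mem (x := ⟨h, hh⟩) hy, rfl⟩)
      rcases this with h | h
      · refine absurd ?_ hN
        rw [LieSubmodule.eq_bot_iff]
        exact fun x hx ↦ Subtype.ext ((Submodule.eq_bot_iff _).mp h x ⟨x, hx, rfl⟩)
      · rw [eq_top_iff]
        rintro x -
        obtain ⟨y, hy, hyx⟩ := h x x.2
        exact (Subtype.ext hyx : y = x) ▸ hy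
    have _ : LieModule.IsFaithful ℂ 𝔥 𝔪 := by
      rw [LieModule.isFaithful_iff']
      exact fun x hx ↦ Subtype.ext (hfaith x x.2 fun m hm ↦ congrArg Subtype.val (hx ⟨m, hm⟩))
    exact Or.inr (Or.inr ⟨𝔪, hab, hd, hsupp hne, hne, hirr, hfaith,
      exists_isSemisimple_isLieAbelian_of_isIrreducible_of_isFaithful ℂ 𝔥 𝔪⟩)
end

section
/- Let 𝔤 be a finite-dimensional Lie algebra over ℂ, let 𝔪 be an abelian Lie ideal of 𝔤 and 𝔥 a Lie subalgebra of 𝔤 with 𝔥 ∩ 𝔪 = 0 and 𝔥 + 𝔪 = 𝔤 (so 𝔤 = 𝔥 ⋉ 𝔪). Assume that 𝔪 is an irreducible and faithful 𝔥-module under the adjoint action. Then 𝔥 is maximal among proper Lie subalgebras of 𝔤, and 𝔥 contains no nonzero Lie ideal of 𝔤; i.e. (𝔤,𝔥) is an effective primitive pair. -/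
/-- Converse part of Morozov's theorem in the affine case: if `𝔤 = 𝔥 ⋉ 𝔪` with `𝔪`
an abelian ideal which is an irreducible faithful `𝔥`-module, then `(𝔤, 𝔥)` is an
effective primitive pair. -/
theorem affine_type_is_primitive_effective
    (L : Type*) [LieRing L] [LieAlgebra ℂ L] [FiniteDimensional ℂ L]
    (𝔪 : LieIdeal ℂ L) (habelian : IsLieAbelian ↥𝔪)
    (𝔥 : LieSubalgebra ℂ L)
    (hdisj : ∀ x : L, x ∈ 𝔥 → x ∈ 𝔪 → x = 0)
    (hsum : ∀ g : L, ∃ x ∈ 𝔥, g - x ∈ 𝔪)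
    (hne : 𝔪 ≠ ⊥)
    (hirred : ∀ p : Submodule ℂ L, (∀ x ∈ p, x ∈ 𝔪) →
      (∀ h ∈ 𝔥, ∀ x ∈ p, ⁅h, x⁆ ∈ p) → p = ⊥ ∨ ∀ x ∈ 𝔪, x ∈ p)
    (hfaithful : ∀ h ∈ 𝔥, (∀ x ∈ 𝔪, ⁅h, x⁆ = 0) → h = 0) :
    (𝔥 ≠ ⊤ ∧ ∀ 𝔩 : LieSubalgebra ℂ L, 𝔥 ≤ 𝔩 → 𝔩 = 𝔥 ∨ 𝔩 = ⊤) ∧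
    (∀ 𝔨 : LieIdeal ℂ L, (∀ x ∈ 𝔨, x ∈ 𝔥) → 𝔨 = ⊥) := by
  refine ⟨⟨?_, fun 𝔩 hl => ?_⟩, fun 𝔨 hk => ?_⟩
  · rintro rfl
    exact hne ((LieSubmodule.eq_bot_iff 𝔪).2 fun x hx => hdisj x (LieSubalgebra.mem_top x) hx)
  · have key := hirred (𝔩.toSubmodule ⊓ 𝔪.toSubmodule) (fun x hx => hx.2)
      fun h hh x hx => ⟨𝔩.lie_mem (hl hh) hx.1, 𝔪.lie_mem hx.2⟩
    rcases key with hbot | hall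
    · refine Or.inl (le_antisymm (fun g hg => ?_) hl)
      obtain ⟨x, hx, hgx⟩ := hsum g
      have hmem : g - x ∈ 𝔩.toSubmodule ⊓ 𝔪.toSubmodule := ⟨𝔩.sub_mem hg (hl hx), hgx⟩
      rw [hbot, Submodule.mem_bot, sub_eq_zero] at hmem
      rwa [hmem]
    · refine Or.inr (eq_top_iff.2 fun g _ => ?_)
      obtain ⟨x, hx, hgx⟩ := hsum g
      rw [← sub_add_cancel g x]
      exact 𝔩.add_mem (hall _ hgx).1 (hl hx)
  · refine (LieSubmodule.eq_bot_iff 𝔨).2 fun k hkk => hfaithful k (hk k hkk) fun x hx => ?_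
    exact hdisj _ (hk _ (lie_mem_left ℂ L 𝔨 k x hkk)) (𝔪.lie_mem hx)
end
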